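/- arXiv:math/9607226 — 2 statements merged into one kernel-verified Lean document; each statement's English description precedes it below -/
import Mathlib

section
/- The relation ≤_i is transitive: for finite structures A ⊆ B ⊆ C with C ∈ K_α, if A ≤_i B and B ≤_i C then A ≤_i C. -/
open FirstOrder Filter Topology
open scoped Classical

/-- The finite relational language with relation symbols `R i` of arity `k i`, for `i : Fin p`. -/
def Lang (p : ℕ) (k : Fin p → ℕ) : FirstOrder.Language where
  Functions := fun _ => Empty
  Relations := fun n => { i : Fin p // k i = n }

variable {p : ℕ}

section StructureDefs

/-- The relation `R i` holds on the finite set `C` (set-version of the relation). -/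
def HoldsOn (k : Fin p → ℕ) {M : Type*} [(Lang p k).Structure M]
    (i : Fin p) (C : Finset M) : Prop :=
  ∃ v : Fin (k i) → M, Function.Injective v ∧ Finset.image v Finset.univ = C ∧
    Language.Structure.RelMap (L := Lang p k) (⟨i, rfl⟩ : (Lang p k).Relations (k i)) v

/-- `w i A` : the number of `k i`-element subsets of `A` on which `R i` holds. -/
noncomputable def w (k : Fin p → ℕ) {M : Type*} [(Lang p k).Structure M]
    (i : Fin p) (A : Finset M) : ℕ :=
  Set.ncard {C : Finset M | C ⊆ A ∧ C.card = k i ∧ HoldsOn k i C}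

/-- `e(A) = Σ_i α_i · w_i(A)`. -/
noncomputable def eVal (k : Fin p → ℕ) (α : Fin p → ℝ) {M : Type*} [(Lang p k).Structure M]
    (A : Finset M) : ℝ :=
  ∑ i : Fin p, α i * (w k i A : ℝ)

/-- `δ(A) = |A| − e(A)`. -/
noncomputable def delta (k : Fin p → ℕ) (α : Fin p → ℝ) {M : Type*} [(Lang p k).Structure M]
    (A : Finset M) : ℝ :=
  (A.card : ℝ) - eVal k α A

/-- A structure is symmetric and irreflexive: relations hold only on tuples of pairwise
distinct elements and are invariant under permutations of the tuple. -/
def SymmIrr (k : Fin p → ℕ) (M : Type*) [(Lang p k).Structure M] : Prop :=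
  (∀ (n : ℕ) (r : (Lang p k).Relations n) (v : Fin n → M),
      Language.Structure.RelMap r v → Function.Injective v) ∧
  (∀ (n : ℕ) (r : (Lang p k).Relations n) (v : Fin n → M) (σ : Equiv.Perm (Fin n)),
      Language.Structure.RelMap r v → Language.Structure.RelMap r (v ∘ σ))

/-- Membership in the class `K`: a symmetric irreflexive structure all of whose finite
substructures have (hereditarily) nonnegative `δ`. -/
def InK (k : Fin p → ℕ) (α : Fin p → ℝ) (M : Type*) [(Lang p k).Structure M] : Prop :=
  SymmIrr k M ∧ ∀ A : Finset M, 0 ≤ delta k α A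

/-- A finite structure is in `K_α` if it is symmetric irreflexive and `δ(A) ≥ 0` for every
substructure. -/
def InKalpha (k : Fin p → ℕ) (α : Fin p → ℝ) (B : Type*) [(Lang p k).Structure B] : Prop :=
  SymmIrr k B ∧ ∀ S : Finset B, 0 ≤ delta k α S

/-- `d_B(X) = inf { δ(Y) : X ⊆ Y ⊆ B }` (relative version, inside the finite set `B`). -/
noncomputable def dRel (k : Fin p → ℕ) (α : Fin p → ℝ) {M : Type*} [(Lang p k).Structure M]
    (B X : Finset M) : ℝ :=
  sInf {r : ℝ | ∃ Y : Finset M, X ⊆ Y ∧ Y ⊆ B ∧ r = delta k α Y}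

/-- `A ≤_s B` for finite sets: `A ⊆ B` and `d_A(X) = d_B(X)` for all `X ⊆ A`. -/
def StrongIn (k : Fin p → ℕ) (α : Fin p → ℝ) {M : Type*} [(Lang p k).Structure M]
    (A B : Finset M) : Prop :=
  A ⊆ B ∧ ∀ X : Finset M, X ⊆ A → dRel k α A X = dRel k α B X

/-- `A ≤_i B` (intrinsic extension): there is no `A'` with `A ⊆ A' ⊊ B` and `A' ≤_s B`. -/
def IntrinsicIn (k : Fin p → ℕ) (α : Fin p → ℝ) {M : Type*} [(Lang p k).Structure M]
    (A B : Finset M) : Prop :=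
  A ⊆ B ∧ ∀ A' : Finset M, A ⊆ A' → A' ⊂ B → ¬ StrongIn k α A' B

/-- `cl^m_M(A)`: the union of all `B ⊆ M` with `A ≤_i B` and `|B − A| < m`. -/
def cl (k : Fin p → ℕ) (α : Fin p → ℝ) {M : Type*} [(Lang p k).Structure M]
    (m : ℕ) (A : Finset M) : Set M :=
  {x : M | ∃ B : Finset M, IntrinsicIn k α A B ∧ (B \ A).card < m ∧ x ∈ B}

/-- `C` and `B'` are freely joined over `A` (inside the ambient structure): they intersect in
`A` and every relation on a subset of `C ∪ B'` lives entirely inside `C` or inside `B'`. -/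
def FreelyJoined (k : Fin p → ℕ) {M : Type*} [(Lang p k).Structure M]
    (A C B' : Set M) : Prop :=
  C ∩ B' = A ∧
    ∀ (i : Fin p) (S : Finset M), ↑S ⊆ C ∪ B' → HoldsOn k i S → (↑S ⊆ C ∨ ↑S ⊆ B')

/-- `g` is an embedding (of relational structures). -/
def IsEmb (k : Fin p → ℕ) {M N : Type*} [(Lang p k).Structure M] [(Lang p k).Structure N]
    (g : M → N) : Prop :=
  Function.Injective g ∧
    ∀ (n : ℕ) (r : (Lang p k).Relations n) (v : Fin n → M),
      (Language.Structure.RelMap r (g ∘ v) ↔ Language.Structure.RelMap r v)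

/-- `g` restricted to `A` is an embedding of the substructure on `A`. -/
def IsEmbOn (k : Fin p → ℕ) {M N : Type*} [(Lang p k).Structure M] [(Lang p k).Structure N]
    (A : Finset M) (g : M → N) : Prop :=
  Set.InjOn g ↑A ∧
    ∀ (n : ℕ) (r : (Lang p k).Relations n) (v : Fin n → M), (∀ j, v j ∈ A) →
      (Language.Structure.RelMap r (g ∘ v) ↔ Language.Structure.RelMap r v)

/-- `h` restricts to an isomorphism from the induced structure on `S` onto `S'`. -/
def IsIsoOn (k : Fin p → ℕ) {M N : Type*} [(Lang p k).Structure M] [(Lang p k).Structure N]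
    (S : Set M) (S' : Set N) (h : M → N) : Prop :=
  Set.InjOn h S ∧ h '' S = S' ∧
    ∀ (n : ℕ) (r : (Lang p k).Relations n) (v : Fin n → M), (∀ j, v j ∈ S) →
      (Language.Structure.RelMap r (h ∘ v) ↔ Language.Structure.RelMap r v)

/-- A countable structure `M ∈ K` is `(K_α, ≤_s)`-semigeneric if for every `A ≤_s B` with
`B ∈ K_α` finite and every embedding `g` of `A` into `M`, and each `m`, there is an embedding
`ĝ` of `B` into `M` extending `g` whose image adds nothing to the `m`-closure of `gA` and is
freely joined with `cl^m(gA)` over `gA`. -/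
def Semigeneric (k : Fin p → ℕ) (α : Fin p → ℝ) (M : Type*) [(Lang p k).Structure M] : Prop :=
  Countable M ∧ InK k α M ∧
    ∀ (B : Type) (_ : Fintype B) (_ : (Lang p k).Structure B), InKalpha k α B →
      ∀ A : Finset B, StrongIn k α A Finset.univ →
        ∀ g : B → M, IsEmbOn k A g → ∀ m : ℕ,
          ∃ g' : B → M, IsEmb k g' ∧ (∀ a ∈ A, g' a = g a) ∧
            cl k α m (Finset.image g' Finset.univ) =
              ↑(Finset.image g' Finset.univ) ∪ cl k α m (Finset.image g A) ∧
            FreelyJoined k (↑(Finset.image g A) : Set M) (cl k α m (Finset.image g A))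
              (↑(Finset.image g' Finset.univ))

end StructureDefs

section FormulaDefs

/-- A formula is existential if it is an existential quantifier prefix applied to a
quantifier-free formula. -/
def IsExistential (k : Fin p → ℕ) {r : ℕ} (φ : (Lang p k).Formula (Fin r)) : Prop :=
  ∃ (m : ℕ) (ψ : (Lang p k).BoundedFormula (Fin r) m), ψ.IsQF ∧ φ = ψ.exs

/-- Boolean combinations of existential formulas. -/
inductive IsBoolCombExistential (k : Fin p → ℕ) {r : ℕ} :
    (Lang p k).Formula (Fin r) → Prop
  | of_existential (φ) : IsExistential k φ → IsBoolCombExistential k φ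
  | not (φ) : IsBoolCombExistential k φ → IsBoolCombExistential k φ.not
  | inf (φ ψ) : IsBoolCombExistential k φ → IsBoolCombExistential k ψ →
      IsBoolCombExistential k (φ ⊓ ψ)

end FormulaDefs

section Probability

/-- A configuration of potential relations on `{1,…,n}`: for each relation symbol, a Boolean
choice on each finite subset. -/
abbrev Config (p n : ℕ) := (i : Fin p) → Finset (Fin n) → Bool

/-- The valid configurations: `R i` may only hold on sets of size `k i`. -/
noncomputable def validE (k : Fin p → ℕ) (n : ℕ) : Finset (Config p n) :=
  Finset.univ.filter (fun E => ∀ (i : Fin p) (C : Finset (Fin n)), E i C = true → C.card = k i)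

/-- The probability of the configuration `E`: independently for each `i` and each
`k i`-element set `C`, the relation `R i` holds on `C` with probability `γ i · n^{-α i}`. -/
noncomputable def weight (k : Fin p → ℕ) (α γ : Fin p → ℝ) (n : ℕ) (E : Config p n) : ℝ :=
  ∏ i : Fin p, ∏ C ∈ Finset.univ.filter (fun C : Finset (Fin n) => C.card = k i),
    (if E i C = true then γ i * (n : ℝ) ^ (-(α i)) else 1 - γ i * (n : ℝ) ^ (-(α i)))

/-- The probability `P_n` of an event (a set of configurations). -/
noncomputable def Pev (k : Fin p → ℕ) (α γ : Fin p → ℝ) (n : ℕ)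
    (Q : Config p n → Prop) : ℝ :=
  ∑ E ∈ validE k n, if Q E then weight k α γ n E else 0

/-- The random `L⁺`-structure `G_n` on `Fin n` determined by the configuration `E`. -/
def structOf (k : Fin p → ℕ) (n : ℕ) (E : Config p n) : (Lang p k).Structure (Fin n) where
  funMap := fun {_} f _ => f.elim
  RelMap := fun {_} r v => Function.Injective v ∧ E r.1 (Finset.image v Finset.univ) = true

/-- The probability that `G_n ⊨ φ`. -/
noncomputable def Pn (k : Fin p → ℕ) (α γ : Fin p → ℝ) (n : ℕ)
    (φ : (Lang p k).Sentence) : ℝ :=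
  Pev k α γ n (fun E => letI := structOf k n E; (Fin n) ⊨ φ)

/-- The Irrationality Hypothesis: `α_0, …, α_{p−1}, 1` are linearly independent over `ℚ`. -/
def IrrHyp (α : Fin p → ℝ) : Prop :=
  LinearIndependent ℚ (Fin.snoc α (1 : ℝ) : Fin (p + 1) → ℝ)

/-- The almost sure theory `T^α`: the sentences with limit probability 1. -/
noncomputable def Talpha (k : Fin p → ℕ) (α γ : Fin p → ℝ) : (Lang p k).Theory :=
  {φ : (Lang p k).Sentence | Tendsto (fun n => Pn k α γ n φ) atTop (𝓝 1)}

/-- Auxiliary: `M`, equipped with the structure `S`, satisfies the sentence `φ`. -/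
def RealizeS (k : Fin p → ℕ) (M : Type*) (S : (Lang p k).Structure M)
    (φ : (Lang p k).Sentence) : Prop :=
  letI := S; M ⊨ φ

/-- Auxiliary: `M`, equipped with the structure `S`, is a model of the theory `T`. -/
def ModelsT (k : Fin p → ℕ) (M : Type*) (S : (Lang p k).Structure M)
    (T : (Lang p k).Theory) : Prop :=
  ∀ φ ∈ T, RealizeS k M S φ

end Probability


section Submodularity

variable {k : Fin p → ℕ} {α : Fin p → ℝ} {N : Type*} [(Lang p k).Structure N]

theorem w_add_le (i : Fin p) (A B : Finset N) :
    w k i A + w k i B ≤ w k i (A ∪ B) + w k i (A ∩ B) := by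
  have hfin (S : Finset N) :
      {C : Finset N | C ⊆ S ∧ C.card = k i ∧ HoldsOn k i C}.Finite :=
    S.powerset.finite_toSet.subset fun C hC => by simpa using hC.1
  have hinter : {C : Finset N | C ⊆ A ∩ B ∧ C.card = k i ∧ HoldsOn k i C} =
      {C : Finset N | C ⊆ A ∧ C.card = k i ∧ HoldsOn k i C} ∩
        {C : Finset N | C ⊆ B ∧ C.card = k i ∧ HoldsOn k i C} := by
    ext C
    simp only [Set.mem_ofPred_eq, Set.mem_inter_iff, Finset.subset_inter_iff]
    tauto
  unfold w
  rw [hinter, ← Set.ncard_union_add_ncard_inter _ _ (hfin A) (hfin B)]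
  gcongr
  · exact hfin _
  · rintro C (hC | hC)
    · exact ⟨hC.1.trans Finset.subset_union_left, hC.2⟩
    · exact ⟨hC.1.trans Finset.subset_union_right, hC.2⟩

/-- The predimension `δ` is submodular. -/
theorem delta_union_add_delta_inter_le (hα : ∀ i, 0 ≤ α i) (A B : Finset N) :
    delta k α (A ∪ B) + delta k α (A ∩ B) ≤ delta k α A + delta k α B := by
  have hcard : ((A ∪ B).card : ℝ) + (A ∩ B).card = A.card + B.card := by
    exact_mod_cast Finset.card_union_add_card_inter A B
  have he : eVal k α A + eVal k α B ≤ eVal k α (A ∪ B) + eVal k α (A ∩ B) := by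
    simp only [eVal, ← Finset.sum_add_distrib, ← mul_add]
    refine Finset.sum_le_sum fun i _ => mul_le_mul_of_nonneg_left ?_ (hα i)
    exact_mod_cast w_add_le (k := k) i A B
  unfold delta
  linarith

theorem bddBelow_delta (B X : Finset N) :
    BddBelow {r : ℝ | ∃ Y : Finset N, X ⊆ Y ∧ Y ⊆ B ∧ r = delta k α Y} := by
  refine ((B.powerset.finite_toSet.image (delta k α)).subset ?_).bddBelow
  rintro r ⟨Y, -, hY, rfl⟩
  exact ⟨Y, by simpa using hY, rfl⟩

theorem dRel_le_delta {B X Y : Finset N} (hXY : X ⊆ Y) (hYB : Y ⊆ B) :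
    dRel k α B X ≤ delta k α Y :=
  csInf_le (bddBelow_delta B X) ⟨Y, hXY, hYB, rfl⟩

theorem le_dRel {B X : Finset N} (hXB : X ⊆ B) {c : ℝ}
    (h : ∀ Y, X ⊆ Y → Y ⊆ B → c ≤ delta k α Y) : c ≤ dRel k α B X :=
  le_csInf ⟨_, X, subset_rfl, hXB, rfl⟩ <| by
    rintro r ⟨Y, hXY, hYB, rfl⟩
    exact h Y hXY hYB

theorem strongIn_iff_delta_inter_le (hα : ∀ i, 0 ≤ α i) {A B : Finset N} :
    StrongIn k α A B ↔ A ⊆ B ∧ ∀ Y ⊆ B, delta k α (Y ∩ A) ≤ delta k α Y := by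
  refine and_congr_right fun hAB => ⟨fun h Y hY => ?_, fun h X hX => le_antisymm ?_ ?_⟩
  · have hA : delta k α A ≤ dRel k α A A :=
      le_dRel subset_rfl fun Z h₁ h₂ => by rw [subset_antisymm h₁ h₂]
    have hAY : dRel k α B A ≤ delta k α (Y ∪ A) :=
      dRel_le_delta Finset.subset_union_right (Finset.union_subset hY hAB)
    linarith [h A subset_rfl, delta_union_add_delta_inter_le (k := k) hα Y A]
  · exact le_dRel (hX.trans hAB) fun Y hXY hYB =>
      (dRel_le_delta (Finset.subset_inter hXY hX) Finset.inter_subset_right).trans (h Y hYB)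
  · exact le_dRel hX fun Y hXY hYA => dRel_le_delta hXY (hYA.trans hAB)

/-- Strongness is inherited by the trace on a smaller ambient set. -/
theorem StrongIn.inter_of_subset (hα : ∀ i, 0 ≤ α i) {A B C : Finset N}
    (h : StrongIn k α A C) (hBC : B ⊆ C) : StrongIn k α (A ∩ B) B := by
  rw [strongIn_iff_delta_inter_le hα] at h ⊢
  refine ⟨Finset.inter_subset_right, fun Y hY => ?_⟩
  have hYAB : Y ∩ (A ∩ B) = Y ∩ A := by
    rw [← Finset.inter_assoc]
    exact Finset.inter_eq_left.2 (Finset.inter_subset_left.trans hY)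
  rw [hYAB]
  exact h.2 Y (hY.trans hBC)

end Submodularity

-- STATEMENT 12
theorem intrinsic_trans (k : Fin p → ℕ) (α : Fin p → ℝ)
    (hα : ∀ i, 0 < α i ∧ α i ≤ 1) (N : Type*) [(Lang p k).Structure N]
    (hN : SymmIrr k N) (A B C : Finset N) (hAB : A ⊆ B) (hBC : B ⊆ C)
    (hC : ∀ C' : Finset N, C' ⊆ C → 0 ≤ delta k α C')
    (h1 : IntrinsicIn k α A B) (h2 : IntrinsicIn k α B C) :
    IntrinsicIn k α A C := by
  refine ⟨hAB.trans hBC, fun A' hAA' hA'C hA' => ?_⟩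
  by_cases hBA' : B ⊆ A'
  · exact h2.2 A' hBA' hA'C hA'
  · refine h1.2 (A' ∩ B) (Finset.subset_inter hAA' hAB)
      (Finset.inter_subset_right.ssubset_of_not_subset fun h => ?_)
      (hA'.inter_of_subset (fun i => (hα i).1.le) hBC)
    exact hBA' (h.trans Finset.inter_subset_left)
end

section
/- If B is a finite symmetric irreflexive L⁺-structure with δ(B) < 0, then the probability that the random structure G_n contains an embedded copy of B tends to 0 as n → ∞; that is, almost always there is no embedding of B into G_n. -/
open FirstOrder Filter Topology
open scoped Classical

variable {p : ℕ}

/-- The edge probability `γ·n^{−α}` is at most `n^{−α}`, and lies in `[0, 1]`. -/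
lemma edgeProb_bounds {a c : ℝ} (ha : 0 < a) (hc : 0 < c ∧ c ≤ 1) {n : ℕ} (hn : 1 ≤ n) :
    0 ≤ c * (n : ℝ) ^ (-a) ∧ c * (n : ℝ) ^ (-a) ≤ (n : ℝ) ^ (-a) ∧ c * (n : ℝ) ^ (-a) ≤ 1 := by
  have hn' : (1 : ℝ) ≤ n := by exact_mod_cast hn
  have h0 : 0 ≤ (n : ℝ) ^ (-a) := Real.rpow_nonneg (by linarith) _
  have h1 : (n : ℝ) ^ (-a) ≤ 1 := Real.rpow_le_one_of_one_le_of_nonpos hn' (by linarith)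
  have h2 : c * (n : ℝ) ^ (-a) ≤ (n : ℝ) ^ (-a) := mul_le_of_le_one_left h0 hc.2
  exact ⟨mul_nonneg hc.1.le h0, h2, h2.trans h1⟩

/-- The sum over all configurations of a product of local factors is the product of the local
sums. -/
lemma sum_config_prod (n : ℕ) (F : Fin p → Finset (Fin n) → Bool → ℝ) :
    ∑ E : Config p n, ∏ i, ∏ C, F i C (E i C) = ∏ i, ∏ C, (F i C true + F i C false) := by
  have h1 := fun i => Finset.prod_univ_sum (fun _ : Finset (Fin n) => (Finset.univ : Finset Bool))
    (F i)
  have h2 := Finset.prod_univ_sum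
    (fun _ : Fin p => (Finset.univ : Finset (Finset (Fin n) → Bool)))
    (fun i x => ∏ C, F i C (x C))
  simp only [Fintype.piFinset_univ, Fintype.sum_bool] at h1 h2
  rw [← h2]
  exact Finset.prod_congr rfl fun i _ => (h1 i).symm

lemma weight_nonneg (k : Fin p → ℕ) (α γ : Fin p → ℝ)
    (hα : ∀ i, 0 < α i ∧ α i ≤ 1) (hγ : ∀ i, 0 < γ i ∧ γ i ≤ 1) {n : ℕ} (hn : 1 ≤ n)
    (E : Config p n) : 0 ≤ weight k α γ n E := by
  refine Finset.prod_nonneg fun i _ => Finset.prod_nonneg fun C _ => ?_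
  have hq := edgeProb_bounds (hα i).1 (hγ i) hn
  split_ifs
  · exact hq.1
  · linarith [hq.2.2]

/-- The weight of the truth value `b` for a relation on `C`, where `q` is the probability that it
holds, the relation is required to hold if `C ∈ T`, and it can only hold on sets of size `m`. -/
noncomputable def forcedWeight {n : ℕ} (T : Finset (Finset (Fin n))) (m : ℕ) (q : ℝ)
    (C : Finset (Fin n)) (b : Bool) : ℝ :=
  if C ∈ T then (if b = true then q else 0)
  else if C.card = m then (if b = true then q else 1 - q)
  else (if b = true then 0 else 1)

lemma forcedWeight_nonneg {n : ℕ} (T : Finset (Finset (Fin n))) (m : ℕ) {q : ℝ}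
    (h0 : 0 ≤ q) (h1 : q ≤ 1) (C : Finset (Fin n)) (b : Bool) :
    0 ≤ forcedWeight T m q C b := by
  unfold forcedWeight
  split_ifs <;> linarith

lemma prod_forcedWeight_add {n : ℕ} (T : Finset (Finset (Fin n))) (m : ℕ) (q : ℝ) :
    ∏ C, (forcedWeight T m q C true + forcedWeight T m q C false) = q ^ T.card := by
  have h : ∀ C, forcedWeight T m q C true + forcedWeight T m q C false =
      if C ∈ T then q else 1 := by
    intro C
    unfold forcedWeight
    split_ifs <;> simp_all
  simp only [h]
  rw [Finset.prod_ite_mem, Finset.univ_inter, Finset.prod_const]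

/-- An event forcing `R i` to hold on every member of `T i` has probability at most
`∏ i, (γ i · n^{−α i})^|T i|`. -/
lemma Pev_le_prod (k : Fin p → ℕ) (α γ : Fin p → ℝ)
    (hα : ∀ i, 0 < α i ∧ α i ≤ 1) (hγ : ∀ i, 0 < γ i ∧ γ i ≤ 1) {n : ℕ} (hn : 1 ≤ n)
    (T : Fin p → Finset (Finset (Fin n))) (hT : ∀ i, ∀ C ∈ T i, C.card = k i)
    (Q : Config p n → Prop) (hQ : ∀ E, Q E → ∀ i, ∀ C ∈ T i, E i C = true) :
    Pev k α γ n Q ≤ ∏ i, (γ i * (n : ℝ) ^ (-(α i))) ^ (T i).card := by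
  have hq := fun i => edgeProb_bounds (hα i).1 (hγ i) hn
  let F : Fin p → Finset (Fin n) → Bool → ℝ := fun i =>
    forcedWeight (T i) (k i) (γ i * (n : ℝ) ^ (-(α i)))
  have hF0 : ∀ E : Config p n, 0 ≤ ∏ i, ∏ C, F i C (E i C) := fun E =>
    Finset.prod_nonneg fun i _ => Finset.prod_nonneg fun C _ =>
      forcedWeight_nonneg _ _ (hq i).1 (hq i).2.2 _ _
  calc Pev k α γ n Q ≤ ∑ E ∈ validE k n, ∏ i, ∏ C, F i C (E i C) := by
        refine Finset.sum_le_sum fun E hE => ?_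
        have hE' : ∀ i C, E i C = true → C.card = k i := (Finset.mem_filter.mp hE).2
        split_ifs with hQE
        · refine le_of_eq (Finset.prod_congr rfl fun i _ => ?_)
          rw [Finset.prod_filter]
          refine Finset.prod_congr rfl fun C _ => ?_
          have h1 := hE' i C
          have h2 := hQ E hQE i C
          have h3 := hT i C
          simp only [F, forcedWeight]
          by_cases hC : C ∈ T i
          · rw [if_pos hC, if_pos (h3 hC), if_pos (h2 hC), if_pos (h2 hC)]
          · rw [if_neg hC]
            by_cases hk : C.card = k i
            · rw [if_pos hk, if_pos hk]
            · rw [if_neg hk, if_neg hk, if_neg fun h => hk (h1 h)]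
        · exact hF0 E
    _ ≤ ∑ E : Config p n, ∏ i, ∏ C, F i C (E i C) :=
        Finset.sum_le_univ_sum_of_nonneg hF0
    _ = ∏ i, ∏ C, (F i C true + F i C false) := sum_config_prod n F
    _ = ∏ i, (γ i * (n : ℝ) ^ (-(α i))) ^ (T i).card :=
        Finset.prod_congr rfl fun i _ => prod_forcedWeight_add _ _ _

lemma Pev_nonneg (k : Fin p → ℕ) (α γ : Fin p → ℝ)
    (hα : ∀ i, 0 < α i ∧ α i ≤ 1) (hγ : ∀ i, 0 < γ i ∧ γ i ≤ 1) {n : ℕ} (hn : 1 ≤ n)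
    (Q : Config p n → Prop) : 0 ≤ Pev k α γ n Q := by
  refine Finset.sum_nonneg fun E _ => ?_
  split_ifs
  · exact weight_nonneg k α γ hα hγ hn E
  · exact le_rfl

/-- The union bound for `Pev`. -/
lemma Pev_exists_le (k : Fin p → ℕ) (α γ : Fin p → ℝ)
    (hα : ∀ i, 0 < α i ∧ α i ≤ 1) (hγ : ∀ i, 0 < γ i ∧ γ i ≤ 1) {n : ℕ} (hn : 1 ≤ n)
    {ι : Type*} [Fintype ι] (Q : ι → Config p n → Prop) :
    Pev k α γ n (fun E => ∃ g, Q g E) ≤ ∑ g, Pev k α γ n (Q g) := by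
  unfold Pev
  rw [Finset.sum_comm]
  refine Finset.sum_le_sum fun E _ => ?_
  have hw := weight_nonneg k α γ hα hγ hn E
  have hnn : ∀ g ∈ (Finset.univ : Finset ι), 0 ≤ if Q g E then weight k α γ n E else 0 := by
    intro g _
    split_ifs
    · exact hw
    · exact le_rfl
  split_ifs with h
  · obtain ⟨g, hg⟩ := h
    have := Finset.single_le_sum hnn (Finset.mem_univ g)
    rwa [if_pos hg] at this
  · exact Finset.sum_nonneg hnn

/-- An embedding into `G_n` carries every set on which `R i` holds to a set in the configuration. -/
lemma IsEmb.config_image (k : Fin p → ℕ) {B : Type*} [(Lang p k).Structure B] {n : ℕ}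
    {E : Config p n} {g : B → Fin n} (hg : letI := structOf k n E; IsEmb k g)
    {i : Fin p} {C : Finset B} (hC : HoldsOn k i C) : E i (C.image g) = true := by
  obtain ⟨v, -, rfl, hv⟩ := hC
  let := structOf k n E
  have h := (hg.2 _ _ v).2 hv
  rw [Finset.image_image]
  exact h.2

/-- A given map is an embedding of `B` into `G_n` with probability at most `n^{−e(B)}`. -/
lemma Pev_isEmb_le (k : Fin p → ℕ) (α γ : Fin p → ℝ)
    (hα : ∀ i, 0 < α i ∧ α i ≤ 1) (hγ : ∀ i, 0 < γ i ∧ γ i ≤ 1) {n : ℕ} (hn : 1 ≤ n)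
    {B : Type*} [Fintype B] [(Lang p k).Structure B] (g : B → Fin n) :
    Pev k α γ n (fun E => letI := structOf k n E; IsEmb k g) ≤
      (n : ℝ) ^ (-(eVal k α (Finset.univ : Finset B))) := by
  have hn' : (0 : ℝ) < n := by exact_mod_cast hn
  by_cases hinj : Function.Injective g
  swap
  · have : Pev k α γ n (fun E => letI := structOf k n E; IsEmb k g) = 0 :=
      Finset.sum_eq_zero fun E _ => if_neg fun h => hinj h.1
    rw [this]
    positivity
  let S : Fin p → Finset (Finset B) := fun i =>
    Finset.univ.filter fun C => C.card = k i ∧ HoldsOn k i C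
  have hS : ∀ i, (S i).card = w k i (Finset.univ : Finset B) := by
    intro i
    rw [w, ← Set.ncard_coe_finset]
    congr 1
    ext C
    simp [S]
  refine (Pev_le_prod k α γ hα hγ hn (fun i => (S i).image (Finset.image g)) ?_ _ ?_).trans ?_
  · intro i C hC
    obtain ⟨D, hD, rfl⟩ := Finset.mem_image.mp hC
    rw [Finset.card_image_of_injective _ hinj]
    exact (Finset.mem_filter.mp hD).2.1
  · intro E hE i C hC
    obtain ⟨D, hD, rfl⟩ := Finset.mem_image.mp hC
    exact IsEmb.config_image k hE (Finset.mem_filter.mp hD).2.2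
  · calc ∏ i, (γ i * (n : ℝ) ^ (-(α i))) ^ ((S i).image (Finset.image g)).card
        ≤ ∏ i, (n : ℝ) ^ (-(α i * (w k i (Finset.univ : Finset B) : ℝ))) := by
          refine Finset.prod_le_prod (fun i _ => ?_) fun i _ => ?_
          · exact pow_nonneg (edgeProb_bounds (hα i).1 (hγ i) hn).1 _
          · rw [Finset.card_image_of_injective _ (Finset.image_injective hinj), hS,
              ← neg_mul, Real.rpow_mul hn'.le, Real.rpow_natCast]
            have hb := edgeProb_bounds (hα i).1 (hγ i) hn
            exact pow_le_pow_left₀ hb.1 hb.2.1 _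
      _ = (n : ℝ) ^ (-(eVal k α (Finset.univ : Finset B))) := by
          rw [← Real.rpow_sum_of_pos hn', eVal, Finset.sum_neg_distrib]

theorem no_copy_of_negative_delta (k : Fin p → ℕ) (α γ : Fin p → ℝ)
    (hα : ∀ i, 0 < α i ∧ α i ≤ 1) (hγ : ∀ i, 0 < γ i ∧ γ i ≤ 1)
    (B : Type) [Fintype B] [(Lang p k).Structure B] (hB : SymmIrr k B)
    (hδ : delta k α (Finset.univ : Finset B) < 0) :
    Tendsto (fun n => Pev k α γ n (fun E =>
        letI := structOf k n E; ∃ g : B → Fin n, IsEmb k g))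
      atTop (𝓝 0) := by
  have hlim : Tendsto (fun n : ℕ => (n : ℝ) ^ (delta k α (Finset.univ : Finset B)))
      atTop (𝓝 0) := by
    have h := (tendsto_rpow_neg_atTop (neg_pos.mpr hδ)).comp (tendsto_natCast_atTop_atTop (R := ℝ))
    simpa [Function.comp_def] using h
  refine tendsto_of_tendsto_of_tendsto_of_le_of_le' tendsto_const_nhds hlim ?_ ?_
  · filter_upwards [eventually_ge_atTop 1] with n hn
    exact Pev_nonneg k α γ hα hγ hn _
  · filter_upwards [eventually_ge_atTop 1] with n hn
    have hn' : (0 : ℝ) < n := by exact_mod_cast hn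
    refine (Pev_exists_le k α γ hα hγ hn _).trans ((Finset.sum_le_sum fun g _ =>
      Pev_isEmb_le k α γ hα hγ hn g).trans_eq ?_)
    rw [Finset.sum_const, Finset.card_univ, Fintype.card_fun, Fintype.card_fin, nsmul_eq_mul,
      delta, sub_eq_add_neg, Real.rpow_add hn', Real.rpow_natCast, Finset.card_univ]
    push_cast
    rfl
end
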